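/- Let C be an n×m real matrix encoding a hypergraph with real coefficients G in which every vertex has positive degree, and let ℓ be a loop, i.e. an edge of cardinality 1 (exactly one index i satisfies C i ℓ ≠ 0); assume every vertex still has positive degree after column ℓ is deleted. Let L(G) be the normalized Laplacian of C and L(G∖ℓ) the normalized Laplacian of the matrix obtained from C by deleting column ℓ. Then for every k ∈ {1,…,n} with λ_k(L(G)) ≤ 1, one has λ_k(L(G∖ℓ)) ≤ λ_k(L(G)). -/

import Mathlib

open Matrix

/-- The degree of vertex `i` in the hypergraph with real coefficients encoded by
the incidence matrix `C`: `deg i = ∑ e, (C i e)^2`. -/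
noncomputable def hypDeg {n : ℕ} {E : Type*} [Fintype E] (C : Matrix (Fin n) E ℝ) (i : Fin n) :
    ℝ :=
  ∑ e, (C i e) ^ 2

/-- The adjacency matrix of the hypergraph with real coefficients encoded by `C`:
zero on the diagonal and `A i j = -∑ e, C i e * C j e` off the diagonal. -/
noncomputable def hypAdj {n : ℕ} {E : Type*} [Fintype E] (C : Matrix (Fin n) E ℝ) :
    Matrix (Fin n) (Fin n) ℝ :=
  Matrix.of fun i j => if i = j then 0 else -∑ e, C i e * C j e

/-- The normalized Laplacian `L = I - D^{-1/2} A D^{-1/2}`. -/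
noncomputable def hypNormLap {n : ℕ} {E : Type*} [Fintype E] (C : Matrix (Fin n) E ℝ) :
    Matrix (Fin n) (Fin n) ℝ :=
  1 - Matrix.diagonal (fun i => (Real.sqrt (hypDeg C i))⁻¹) * hypAdj C *
      Matrix.diagonal (fun i => (Real.sqrt (hypDeg C i))⁻¹)

open Classical in
/-- The eigenvalues of a real symmetric matrix, listed in nondecreasing order with
multiplicity; `sortedEig A k` is the `(k+1)`-st smallest eigenvalue (0-indexed).
(Junk value `0` if `A` is not symmetric.) -/
noncomputable def sortedEig {n : ℕ} (A : Matrix (Fin n) (Fin n) ℝ) : Fin n → ℝ :=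
  if hA : A.IsHermitian then hA.eigenvalues ∘ Tuple.sort hA.eigenvalues else 0


lemma aux_spec {n : ℕ} (A : Matrix (Fin n) (Fin n) ℝ) (hA : A.IsHermitian) :
    ∃ f : Fin n → Fin n → ℝ, (∀ x : Fin n → ℝ, x ⬝ᵥ x = ∑ j, (f j ⬝ᵥ x) ^ 2) ∧
      (∀ x : Fin n → ℝ, x ⬝ᵥ (A *ᵥ x) = ∑ j, sortedEig A j * (f j ⬝ᵥ x) ^ 2) ∧
      Monotone (sortedEig A) := by
  have hs : sortedEig A = hA.eigenvalues ∘ Tuple.sort hA.eigenvalues := by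
    unfold sortedEig; rw [dif_pos hA]
  set σ := Tuple.sort hA.eigenvalues with hσ
  set U : Matrix (Fin n) (Fin n) ℝ := (hA.eigenvectorUnitary : Matrix (Fin n) (Fin n) ℝ) with hU
  have hUU : U * Uᵀ = 1 := by
    have := Unitary.coe_mul_star_self hA.eigenvectorUnitary
    simpa [Matrix.star_eq_conjTranspose, Matrix.conjTranspose_eq_transpose_of_trivial] using this
  have hAU : A = U * diagonal hA.eigenvalues * Uᵀ := by
    have := hA.spectral_theorem
    rw [Unitary.conjStarAlgAut_apply] at this
    simpa [Matrix.star_eq_conjTranspose, Matrix.conjTranspose_eq_transpose_of_trivial,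
      Function.comp_def] using this
  refine ⟨fun j i => U i (σ j), ?_, ?_, ?_⟩
  · intro x
    rw [Equiv.sum_comp σ (fun j => ((fun i => U i j) ⬝ᵥ x) ^ 2)]
    have : x ⬝ᵥ x = (Uᵀ *ᵥ x) ⬝ᵥ (Uᵀ *ᵥ x) := by
      rw [Matrix.dotProduct_mulVec, Matrix.vecMul_transpose, Matrix.mulVec_mulVec, hUU,
        Matrix.one_mulVec]
    rw [this]
    simp only [dotProduct, Matrix.mulVec, Matrix.transpose_apply, sq]
  · intro x
    rw [hs]
    simp only [Function.comp_apply]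
    rw [Equiv.sum_comp σ (fun j => hA.eigenvalues j * ((fun i => U i j) ⬝ᵥ x) ^ 2)]
    have : x ⬝ᵥ (A *ᵥ x) = (Uᵀ *ᵥ x) ⬝ᵥ (diagonal hA.eigenvalues *ᵥ (Uᵀ *ᵥ x)) := by
      conv_lhs => rw [hAU]
      rw [← Matrix.mulVec_mulVec, ← Matrix.mulVec_mulVec, Matrix.dotProduct_mulVec,
        Matrix.mulVec_transpose]
    rw [this]
    simp only [dotProduct, Matrix.mulVec_diagonal]
    refine Finset.sum_congr rfl fun j _ => ?_
    simp only [Matrix.mulVec, dotProduct, Matrix.transpose_apply]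
    ring
  · rw [hs]; exact Tuple.monotone_sort _

lemma aux_compare {n : ℕ} (A B : Matrix (Fin n) (Fin n) ℝ) (hA : A.IsHermitian)
    (hB : B.IsHermitian) (k : Fin n) (T : (Fin n → ℝ) →ₗ[ℝ] (Fin n → ℝ))
    (hT : Function.Injective T)
    (h : ∀ x : Fin n → ℝ, x ⬝ᵥ (A *ᵥ x) ≤ sortedEig A k * (x ⬝ᵥ x) →
      T x ⬝ᵥ (B *ᵥ T x) ≤ sortedEig A k * (T x ⬝ᵥ T x)) :
    sortedEig B k ≤ sortedEig A k := by
  obtain ⟨f, f1, f2, fm⟩ := aux_spec A hA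
  obtain ⟨g, g1, g2, gm⟩ := aux_spec B hB
  let Φ : (Fin n → ℝ) →ₗ[ℝ] ({j : Fin n // j ≠ k} → ℝ) :=
    { toFun := fun x j => if j.1 < k then g j.1 ⬝ᵥ T x else f j.1 ⬝ᵥ x
      map_add' := by
        intro x y; ext j; by_cases hj : j.1 < k <;> simp [hj]
      map_smul' := by
        intro c x; ext j; by_cases hj : j.1 < k <;> simp [hj] }
  have hker : LinearMap.ker Φ ≠ ⊥ := by
    apply LinearMap.ker_ne_bot_of_finrank_lt
    have : 0 < n := k.pos
    simp
    omega
  obtain ⟨x, hx, hx0⟩ := Submodule.exists_mem_ne_zero_of_ne_bot hker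
  have hΦ : ∀ j : Fin n, j ≠ k → (if j < k then g j ⬝ᵥ T x else f j ⬝ᵥ x) = 0 := fun j hj =>
    congrFun (LinearMap.mem_ker.1 hx) ⟨j, hj⟩
  have h1 : x ⬝ᵥ (A *ᵥ x) ≤ sortedEig A k * (x ⬝ᵥ x) := by
    rw [f1, f2, Finset.mul_sum]
    refine Finset.sum_le_sum fun j _ => ?_
    rcases le_or_gt j k with hj | hj
    · exact mul_le_mul_of_nonneg_right (fm hj) (sq_nonneg _)
    · have := hΦ j hj.ne'
      rw [if_neg hj.not_gt] at this
      simp [this]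
  have h2 : sortedEig B k * (T x ⬝ᵥ T x) ≤ T x ⬝ᵥ (B *ᵥ T x) := by
    rw [g1, g2, Finset.mul_sum]
    refine Finset.sum_le_sum fun j _ => ?_
    rcases le_or_gt k j with hj | hj
    · exact mul_le_mul_of_nonneg_right (gm hj) (sq_nonneg _)
    · have := hΦ j hj.ne
      rw [if_pos hj] at this
      simp [this]
  have hT0 : T x ≠ 0 := fun h0 => hx0 (hT (by rw [h0, map_zero]))
  have hpos : 0 < T x ⬝ᵥ T x := by
    have := dotProduct_self_star_pos_iff.2 hT0
    simpa using this
  exact le_of_mul_le_mul_right (h2.trans (h x h1)) hpos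

lemma aux_symm {n : ℕ} {E : Type*} [Fintype E] (C : Matrix (Fin n) E ℝ) :
    (hypNormLap C).IsHermitian := by
  ext i j
  simp only [hypNormLap, conjTranspose_apply, Matrix.sub_apply, Matrix.mul_diagonal,
    Matrix.diagonal_mul, hypAdj, of_apply, star_trivial, Matrix.one_apply, eq_comm (a := j) (b := i),
    mul_comm (C j _) (C i _)]
  ring

lemma aux_quad {n : ℕ} {E : Type*} [Fintype E] (C : Matrix (Fin n) E ℝ)
    (hdeg : ∀ i, 0 < hypDeg C i) (y : Fin n → ℝ) (x : Fin n → ℝ)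
    (hx : ∀ i, x i = Real.sqrt (hypDeg C i) * y i) :
    x ⬝ᵥ (hypNormLap C *ᵥ x) = (∑ i, hypDeg C i * y i ^ 2) - y ⬝ᵥ (hypAdj C *ᵥ y) ∧
    x ⬝ᵥ x = ∑ i, hypDeg C i * y i ^ 2 := by
  have hxx : x ⬝ᵥ x = ∑ i, hypDeg C i * y i ^ 2 := by
    simp only [dotProduct, hx]
    refine Finset.sum_congr rfl fun i _ => ?_
    have := Real.mul_self_sqrt (hdeg i).le
    linear_combination (y i ^ 2) * this
  refine ⟨?_, hxx⟩
  have hd : diagonal (fun i => (Real.sqrt (hypDeg C i))⁻¹) *ᵥ x = y := by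
    ext i
    rw [Matrix.mulVec_diagonal, hx]
    have := (Real.sqrt_pos.2 (hdeg i)).ne'
    field_simp
  have hd' : x ᵥ* diagonal (fun i => (Real.sqrt (hypDeg C i))⁻¹) = y := by
    rw [← hd]; ext i; rw [Matrix.mulVec_diagonal, Matrix.vecMul_diagonal, mul_comm]
  rw [hypNormLap, Matrix.sub_mulVec, Matrix.one_mulVec, dotProduct_sub, hxx,
    ← Matrix.mulVec_mulVec, ← Matrix.mulVec_mulVec, hd, Matrix.dotProduct_mulVec, hd']

/-- Removing a loop `ℓ` does not increase the eigenvalues of the normalized Laplacian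
that are `≤ 1`. -/
theorem normLap_loop_deletion_le {n m : ℕ} (C : Matrix (Fin n) (Fin m) ℝ)
    (ℓ : Fin m) (hloop : ({i : Fin n | C i ℓ ≠ 0}).ncard = 1)
    (hdeg : ∀ i, 0 < hypDeg C i)
    (hdeg' : ∀ i,
      0 < hypDeg (C.submatrix id (fun e : {e : Fin m // e ≠ ℓ} => (e : Fin m))) i)
    (k : Fin n) (hk : sortedEig (hypNormLap C) k ≤ 1) :
    sortedEig (hypNormLap (C.submatrix id (fun e : {e : Fin m // e ≠ ℓ} => (e : Fin m)))) k ≤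
      sortedEig (hypNormLap C) k := by
  set C' := C.submatrix id (fun e : {e : Fin m // e ≠ ℓ} => (e : Fin m)) with hC'
  have hsum : ∀ f : Fin m → ℝ, ∑ e, f e = f ℓ + ∑ e : {e : Fin m // e ≠ ℓ}, f e := by
    intro f
    rw [Fintype.sum_eq_add_sum_subtype_ne f ℓ]
  have hadj : hypAdj C' = hypAdj C := by
    ext i j
    simp only [hypAdj, of_apply]
    split_ifs with hij
    · rfl
    · rw [hsum]
      have : C i ℓ * C j ℓ = 0 := by
        by_contra hne
        obtain ⟨a, ha⟩ := Set.ncard_eq_one.1 hloop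
        have hi : i ∈ ({a} : Set (Fin n)) := ha ▸ left_ne_zero_of_mul hne
        have hj : j ∈ ({a} : Set (Fin n)) := ha ▸ right_ne_zero_of_mul hne
        exact hij (hi.trans hj.symm)
      rw [this]
      simp [hC']
  have hle : ∀ i, hypDeg C' i ≤ hypDeg C i := by
    intro i
    simp only [hypDeg]
    rw [hsum]
    simp only [hC', submatrix_apply, id]
    linarith [sq_nonneg (C i ℓ)]
  have hne : ∀ i, Real.sqrt (hypDeg C i) ≠ 0 := fun i => (Real.sqrt_pos.2 (hdeg i)).ne'
  have hne' : ∀ i, Real.sqrt (hypDeg C' i) ≠ 0 := fun i => (Real.sqrt_pos.2 (hdeg' i)).ne'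
  refine aux_compare _ _ (aux_symm C) (aux_symm C') k
    (Matrix.toLin' (diagonal fun i => Real.sqrt (hypDeg C' i) * (Real.sqrt (hypDeg C i))⁻¹)) ?_ ?_
  · intro x y hxy
    ext i
    have := congrFun hxy i
    simp only [Matrix.toLin'_apply, Matrix.mulVec_diagonal] at this
    exact mul_left_cancel₀ (mul_ne_zero (hne' i) (inv_ne_zero (hne i))) this
  · intro x hx
    obtain ⟨a1, a2⟩ := aux_quad C hdeg (fun i => (Real.sqrt (hypDeg C i))⁻¹ * x i) x
      (fun i => by rw [mul_inv_cancel_left₀ (hne i)])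
    obtain ⟨b1, b2⟩ := aux_quad C' hdeg' (fun i => (Real.sqrt (hypDeg C i))⁻¹ * x i)
      (Matrix.toLin' (diagonal fun i =>
        Real.sqrt (hypDeg C' i) * (Real.sqrt (hypDeg C i))⁻¹) x)
      (fun i => by rw [Matrix.toLin'_apply, Matrix.mulVec_diagonal, mul_assoc])
    rw [a1, a2] at hx
    rw [b1, b2, hadj]
    have hs : ∑ i, hypDeg C' i * ((Real.sqrt (hypDeg C i))⁻¹ * x i) ^ 2 ≤
        ∑ i, hypDeg C i * ((Real.sqrt (hypDeg C i))⁻¹ * x i) ^ 2 :=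
      Finset.sum_le_sum fun i _ => mul_le_mul_of_nonneg_right (hle i) (sq_nonneg _)
    nlinarith [mul_le_mul_of_nonneg_left hs (sub_nonneg.2 hk)]
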